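/- Let φ: X → (−∞,+∞] be proper, W: X → 2^{X*}, x ∈ dom W, u* ∈ X*, γ > 0, and suppose z ∈ (W + γ∂φ)^{-1}(Wx + γu*). Then there exist x* ∈ Wx and z* ∈ Wz such that L_φ(x,u*) ≥ ⟨x−z, x*−z*⟩/γ. -/

import Mathlib

open scoped Topology

variable {X : Type*} [NormedAddCommGroup X] [NormedSpace ℝ X] [CompleteSpace X]

/-- The Haraux function of a set-valued operator `A : X → 2^{X*}`. -/
noncomputable def haraux (A : X → Set (X →L[ℝ] ℝ)) (x : X) (u : X →L[ℝ] ℝ) : EReal :=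
  ⨆ (p : X × (X →L[ℝ] ℝ)) (_ : p.2 ∈ A p.1), (((p.2 - u) (x - p.1) : ℝ) : EReal)

/-- The Fenchel conjugate of an extended-real-valued function. -/
noncomputable def fconj (f : X → EReal) (u : X →L[ℝ] ℝ) : EReal :=
  ⨆ y : X, (((u y : ℝ) : EReal) - f y)

/-- The convex subdifferential of an extended-real-valued function. -/
def subdiff (f : X → EReal) (x : X) : Set (X →L[ℝ] ℝ) :=
  {xs | ∀ y : X, ((xs (y - x) : ℝ) : EReal) + f x ≤ f y}

/-- The Fenchel–Young function `L_φ(x,u*) = φ(x) + φ*(u*) − ⟨x,u*⟩`. -/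
noncomputable def fenchelYoung (f : X → EReal) (x : X) (u : X →L[ℝ] ℝ) : EReal :=
  f x + fconj f u - ((u x : ℝ) : EReal)

/-- Theorem 3(i): if `z ∈ (W + γ∂φ)⁻¹(Wx + γu*)`, then there exist `x* ∈ Wx` and
`z* ∈ Wz` with `L_φ(x,u*) ≥ ⟨x−z, x*−z*⟩/γ`. -/
theorem fenchelYoung_lower_bound_pairing
    (φ : X → EReal) (hproper : (∃ w, φ w ≠ ⊤) ∧ ∀ w, φ w ≠ ⊥)
    (W : X → Set (X →L[ℝ] ℝ)) (x z : X) (u : X →L[ℝ] ℝ) (γ : ℝ)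
    (hx : (W x).Nonempty) (hγ : 0 < γ)
    (hz : ∃ xs ∈ W x, ∃ w ∈ W z, ∃ a ∈ subdiff φ z, xs + γ • u = w + γ • a) :
    ∃ xs ∈ W x, ∃ zs ∈ W z,
      (((xs - zs) (x - z) / γ : ℝ) : EReal) ≤ fenchelYoung φ x u := by
  obtain ⟨⟨y, hy⟩, hbot⟩ := hproper
  obtain ⟨xs, hxs, w, hw, a, ha, heq⟩ := hz
  refine ⟨xs, hxs, w, hw, ?_⟩
  have hpair : (xs - w) (x - z) / γ = a (x - z) + u z - u x := by
    have h : xs - w = γ • (a - u) := by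
      rw [smul_sub, sub_eq_sub_iff_add_eq_add, heq, add_comm]
    rw [h]
    simp only [smul_apply, sub_apply, map_sub, smul_eq_mul]
    field_simp
    ring
  have hz_top : φ z ≠ ⊤ := by
    intro h
    have hay := ha y
    rw [h, EReal.coe_add_top, top_le_iff] at hay
    exact hy hay
  have hconj : ((u z : ℝ) : EReal) - φ z ≤ fconj φ u :=
    le_iSup (fun v : X => ((u v : ℝ) : EReal) - φ v) z
  have hsub := ha x
  lift φ z to ℝ using ⟨hz_top, hbot z⟩ with r
  have hsum := EReal.sub_le_sub (add_le_add hsub hconj) (le_refl ((u x : ℝ) : EReal))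
  rw [hpair]
  refine le_trans (le_of_eq ?_) hsum
  norm_cast
  ring
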